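/- Let (X,C) be a strongly ordered separable Banach space and Φ : [0,∞) × X → X a C¹-smooth strongly monotone semiflow with compact orbit closures. Assume that for some fixed t₀ > 0, the Fréchet derivative DΦ_{t₀}(x) is a compact operator for every x ∈ X, and DΦ_{t₀}(e) is strongly positive for every equilibrium e. Then the set S_Φ := {x ∈ X : λ_max(x,Φ) > 0} is shy in X. -/

import Mathlib

open Filter Topology MeasureTheory Set Bornology Metric
open scoped ENNReal NNReal

noncomputable section

section Defs

variable {X : Type*} [NormedAddCommGroup X] [NormedSpace ℝ X]

/-- A cone in a Banach space: a closed convex set with `r • C ⊆ C` for all `r > 0`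
and `C ∩ (-C) = {0}`. -/
def IsCone (C : Set X) : Prop :=
  IsClosed C ∧ Convex ℝ C ∧ (∀ r : ℝ, 0 < r → ∀ x ∈ C, r • x ∈ C) ∧ C ∩ (-C) = {0}

/-- `(X, C)` is strongly ordered: `C` is a cone with nonempty interior. -/
def StronglyOrderedCone (C : Set X) : Prop :=
  IsCone C ∧ (interior C).Nonempty

/-- `x < y` in the order induced by the cone `C`. -/
def coneLT (C : Set X) (x y : X) : Prop := y - x ∈ C \ {0}

/-- `x ≤ y` in the order induced by the cone `C`. -/
def coneLE (C : Set X) (x y : X) : Prop := y - x ∈ C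

/-- `x ≪ y` in the order induced by the cone `C`. -/
def coneLLT (C : Set X) (x y : X) : Prop := y - x ∈ interior C

/-- A bounded linear operator is strongly positive (w.r.t. the cone `C`) if
`T v ≫ 0` whenever `v > 0`. -/
def StronglyPositive (C : Set X) (T : X →L[ℝ] X) : Prop :=
  ∀ v : X, v ∈ C \ {0} → T v ∈ interior C

/-- A map between normed spaces is compact if it sends bounded sets to relatively
compact sets. -/
def IsCompactMap {Y Z : Type*} [NormedAddCommGroup Y] [NormedAddCommGroup Z]
    (f : Y → Z) : Prop :=
  ∀ B : Set Y, IsBounded B → IsCompact (closure (f '' B))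

/-- `h` is pointwise dissipative: some nonempty bounded set `B` attracts every point. -/
def PointwiseDissipative (h : X → X) : Prop :=
  ∃ B : Set X, B.Nonempty ∧ IsBounded B ∧
    ∀ x : X, Tendsto (fun n : ℕ => infDist (h^[n] x) B) atTop (nhds 0)

/-- The set `A` attracts the set `B` under iteration of `h`. -/
def AttractsSet (h : X → X) (A B : Set X) : Prop :=
  ∀ ε : ℝ, 0 < ε → ∃ N : ℕ, ∀ n : ℕ, N ≤ n → ∀ x ∈ B, infDist (h^[n] x) A < ε

/-- `A` is an attractor of `h`: the maximal compact invariant set attracting every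
bounded set. -/
def IsAttractor (h : X → X) (A : Set X) : Prop :=
  A.Nonempty ∧ IsCompact A ∧ h '' A = A ∧
    (∀ B : Set X, IsBounded B → AttractsSet h A B) ∧
    (∀ A' : Set X, IsCompact A' → h '' A' = A' → A' ⊆ A)

/-- The ω-limit set `ω(x,h) = ⋂ₖ closure {hⁿ x : n ≥ k}`. -/
def omegaMap (h : X → X) (x : X) : Set X :=
  ⋂ k : ℕ, closure {y : X | ∃ n : ℕ, k ≤ n ∧ y = h^[n] x}

/-- The largest Lyapunov exponent `λ_max(x,h) = liminf (log ‖Dhⁿ(x)‖)/n` (in `EReal`). -/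
def lambdaMax (h : X → X) (x : X) : EReal :=
  atTop.liminf fun n : ℕ => ((Real.log ‖fderiv ℝ (h^[n]) x‖ / n : ℝ) : EReal)

/-- The principal Lyapunov exponent `λ₁(x,h) = limsup (log ‖Dhⁿ(x)‖)/n` (in `EReal`). -/
def lambdaOne (h : X → X) (x : X) : EReal :=
  atTop.limsup fun n : ℕ => ((Real.log ‖fderiv ℝ (h^[n]) x‖ / n : ℝ) : EReal)

/-- `S` is a linearly stable cycle of `h` of minimal period `p`: `S` is the orbit of a
`p`-periodic point `z` with spectral radius of `Dhᵖ(z)` at most `1`. -/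
def IsLinStableCycle (h : X → X) (p : ℕ) (S : Set X) : Prop :=
  ∃ z : X, h^[p] z = z ∧ (∀ l : ℕ, 0 < l → l < p → h^[l] z ≠ z) ∧
    spectralRadius ℝ (fderiv ℝ (h^[p]) z) ≤ 1 ∧ S = {y : X | ∃ n : ℕ, y = h^[n] z}

/-- `S` is a linearly stable cycle of `h` of minimal period at most `m`. -/
def IsLinStableCycleLe (h : X → X) (m : ℕ) (S : Set X) : Prop :=
  ∃ p : ℕ, 0 < p ∧ p ≤ m ∧ IsLinStableCycle h p S

/-- Semiflow axioms for `Φ : ℝ → X → X` (restricted to nonnegative times). -/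
def IsSemiflow (Φ : ℝ → X → X) : Prop :=
  (∀ x : X, Φ 0 x = x) ∧
    (∀ s t : ℝ, 0 ≤ s → 0 ≤ t → ∀ x : X, Φ (t + s) x = Φ t (Φ s x)) ∧
    ContinuousOn (fun p : ℝ × X => Φ p.1 p.2) (Ici (0 : ℝ) ×ˢ (univ : Set X))

/-- The ω-limit set of `x` under a semiflow. -/
def omegaFlow (Φ : ℝ → X → X) (x : X) : Set X :=
  ⋂ s : ℝ, closure {y : X | ∃ t : ℝ, s ≤ t ∧ y = Φ t x}

/-- The largest Lyapunov exponent of `x` w.r.t. a semiflow. -/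
def lambdaMaxFlow (Φ : ℝ → X → X) (x : X) : EReal :=
  atTop.liminf fun t : ℝ => ((Real.log ‖fderiv ℝ (Φ t) x‖ / t : ℝ) : EReal)

/-- The principal Lyapunov exponent of `x` w.r.t. a semiflow. -/
def lambdaOneFlow (Φ : ℝ → X → X) (x : X) : EReal :=
  atTop.limsup fun t : ℝ => ((Real.log ‖fderiv ℝ (Φ t) x‖ / t : ℝ) : EReal)

end Defs

section Shy

variable {X : Type*} [NormedAddCommGroup X] [NormedSpace ℝ X] [MeasurableSpace X]

/-- A Borel set `W` is shy if there is a nonzero compactly supported Borel measure `μ`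
with `μ(x + W) = 0` for every `x`. -/
def IsShy (W : Set X) : Prop :=
  MeasurableSet W ∧
    ∃ μ : Measure X, μ ≠ 0 ∧ (∃ K : Set X, IsCompact K ∧ μ Kᶜ = 0) ∧
      ∀ x : X, μ ((fun w => x + w) '' W) = 0

/-- `W` is prevalent in `V` if `V \ W` is shy. -/
def IsPrevalentIn (V W : Set X) : Prop := IsShy (V \ W)

end Shy

section ConePositivity

variable {X : Type*} [NormedAddCommGroup X] [NormedSpace ℝ X]

theorem IsCone.zero_mem {C : Set X} (hC : IsCone C) : (0 : X) ∈ C := by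
  have h : (0 : X) ∈ C ∩ (-C) := by rw [hC.2.2.2]; rfl
  exact h.1

/-- Every nonzero point of a cone is detected by a nonnegative functional. -/
theorem IsCone.exists_dual_pos {C : Set X} (hC : IsCone C) {x : X} (hx : x ∈ C)
    (hx0 : x ≠ 0) : ∃ f : X →L[ℝ] ℝ, (∀ w ∈ C, 0 ≤ f w) ∧ 0 < f x := by
  have hnx : -x ∉ C := fun h => by
    have : x ∈ C ∩ (-C) := ⟨hx, h⟩
    rw [hC.2.2.2] at this
    exact hx0 this
  obtain ⟨f, u, hfu, hu⟩ := geometric_hahn_banach_closed_point hC.2.1 hC.1 hnx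
  have hu0 : 0 < u := by simpa using hfu 0 hC.zero_mem
  refine ⟨-f, fun w hw => ?_, ?_⟩
  · by_contra! h
    have hfw : 0 < f w := by simpa using h
    have := hfu _ (hC.2.2.1 (u / f w) (by positivity) w hw)
    rw [map_smul, smul_eq_mul, div_mul_cancel₀ _ hfw.ne'] at this
    exact lt_irrefl _ this
  · have : u < -f x := by simpa using hu
    simpa using hu0.trans this

/-- A cone in a separable Banach space admits a strictly positive functional. -/
theorem IsCone.exists_strictlyPositive_dual [TopologicalSpace.SeparableSpace X] {C : Set X}
    (hC : IsCone C) : ∃ f : X →L[ℝ] ℝ, ∀ w ∈ C, w ≠ 0 → 0 < f w := by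
  have : SecondCountableTopology X := UniformSpace.secondCountable_of_separable X
  choose f hf hfpos using fun p : (C \ {0} : Set X) => hC.exists_dual_pos p.2.1 p.2.2
  obtain ⟨T, hT, hTU⟩ := TopologicalSpace.isOpen_iUnion_countable
    (fun p : (C \ {0} : Set X) => {y : X | 0 < f p y})
    (fun p => isOpen_lt continuous_const (f p).continuous)
  obtain ⟨g, hg⟩ := ((hT.image f).insert 0).exists_eq_range ⟨0, Set.mem_insert _ _⟩
  have hgC : ∀ n, ∀ w ∈ C, 0 ≤ g n w := by
    intro n w hw
    have : g n ∈ insert 0 (f '' T) := hg ▸ Set.mem_range_self n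
    rcases this with h | ⟨p, -, h⟩
    · simp [h]
    · exact h ▸ hf p w hw
  have hsum : Summable fun n => ((1 / 2 : ℝ) ^ n * (1 + ‖g n‖)⁻¹) • g n := by
    refine Summable.of_norm_bounded summable_geometric_two fun n => ?_
    have h1 : 0 < 1 + ‖g n‖ := by positivity
    rw [norm_smul, Real.norm_of_nonneg (by positivity), mul_assoc]
    refine mul_le_of_le_one_right (by positivity) ?_
    rw [inv_mul_le_iff₀ h1]
    linarith
  refine ⟨∑' n, ((1 / 2 : ℝ) ^ n * (1 + ‖g n‖)⁻¹) • g n, fun w hw hw0 => ?_⟩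
  have hw' : w ∈ ⋃ p ∈ T, {y : X | 0 < f p y} := by
    rw [hTU]
    exact Set.mem_iUnion.2 ⟨⟨w, hw, hw0⟩, hfpos _⟩
  simp only [Set.mem_iUnion] at hw'
  obtain ⟨p, hpT, hp⟩ := hw'
  obtain ⟨n, hn⟩ : f p ∈ Set.range g := hg ▸ Set.mem_insert_of_mem _ (Set.mem_image_of_mem f hpT)
  have hs := hsum.hasSum.mapL (ContinuousLinearMap.apply ℝ ℝ w)
  refine lt_of_lt_of_le ?_ (le_hasSum hs n fun k _ => ?_)
  · have : 0 < g n w := hn ▸ hp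
    simp only [ContinuousLinearMap.apply_apply, smul_apply, smul_eq_mul]
    positivity
  · have := hgC k w hw
    simp only [ContinuousLinearMap.apply_apply, smul_apply, smul_eq_mul]
    positivity

/-- Along a compact set of parameters, a strictly positive functional controls the norm of the
image of every cone vector whose norm does not decrease under a compact positive operator. -/
theorem IsCompact.exists_mul_norm_le_dual {Y : Type*} [TopologicalSpace Y] {C : Set X}
    (hC : IsCone C) {f : X →L[ℝ] ℝ} (hf : ∀ w ∈ C, w ≠ 0 → 0 < f w) {T : Y → X →L[ℝ] X}
    (hT : Continuous T) (hcpt : ∀ z, IsCompactOperator (T z))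
    (hpos : ∀ z, ∀ u ∈ C, T z u ∈ C) {K : Set Y} (hK : IsCompact K) :
    ∃ δ > 0, ∀ z ∈ K, ∀ u ∈ C, ‖u‖ ≤ ‖T z u‖ → δ * ‖T z u‖ ≤ f (T z u) := by
  refine hK.induction_on
    (p := fun s => ∃ δ > 0, ∀ z ∈ s, ∀ u ∈ C, ‖u‖ ≤ ‖T z u‖ → δ * ‖T z u‖ ≤ f (T z u))
    ⟨1, one_pos, by simp⟩ ?_ ?_ ?_
  · rintro s t hst ⟨δ, hδ, h⟩
    exact ⟨δ, hδ, fun z hz => h z (hst hz)⟩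
  · rintro s t ⟨δ₁, hδ₁, h₁⟩ ⟨δ₂, hδ₂, h₂⟩
    refine ⟨min δ₁ δ₂, lt_min hδ₁ hδ₂, fun z hz u hu hle => ?_⟩
    rcases hz with hz | hz
    · exact (mul_le_mul_of_nonneg_right (min_le_left _ _) (norm_nonneg _)).trans
        (h₁ z hz u hu hle)
    · exact (mul_le_mul_of_nonneg_right (min_le_right _ _) (norm_nonneg _)).trans
        (h₂ z hz u hu hle)
  · intro z₀ _
    obtain ⟨Q, hQ, hTQ⟩ := (hcpt z₀).image_closedBall_subset_compact 1
    have hQ' : IsCompact (Q ∩ (C ∩ {p : X | 1 / 2 ≤ ‖p‖})) :=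
      hQ.inter_right (hC.1.inter (isClosed_le continuous_const continuous_norm))
    obtain ⟨δ, hδ, hδQ⟩ : ∃ δ > 0, ∀ p ∈ Q ∩ (C ∩ {p : X | 1 / 2 ≤ ‖p‖}), 2 * δ ≤ f p := by
      rcases (Q ∩ (C ∩ {p : X | 1 / 2 ≤ ‖p‖})).eq_empty_or_nonempty with h | h
      · exact ⟨1, one_pos, by rw [h]; simp⟩
      · obtain ⟨p, hp, hmin⟩ := hQ'.exists_isMinOn h f.continuous.continuousOn
        have hp0 : p ≠ 0 := by
          rintro rfl
          have : (1 / 2 : ℝ) ≤ ‖(0 : X)‖ := hp.2.2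
          norm_num at this
        refine ⟨f p / 2, half_pos (hf p hp.2.1 hp0), fun q hq => ?_⟩
        have : f p ≤ f q := hmin hq
        linarith
    set η : ℝ := min (1 / 2) (δ / (‖f‖ + 1))
    have hη0 : 0 < η := lt_min (by norm_num) (by positivity)
    refine ⟨{z | ‖T z - T z₀‖ < η}, mem_nhdsWithin_of_mem_nhds ?_, δ / (‖T z₀‖ + 1),
      by positivity, ?_⟩
    · exact (isOpen_lt (by fun_prop) continuous_const).mem_nhds (by simpa using hη0)
    intro z hz u hu hle
    have hz' : ‖T z - T z₀‖ < η := hz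
    rcases eq_or_ne u 0 with rfl | hu0
    · simp
    have hn : 0 < ‖u‖ := norm_pos_iff.2 hu0
    set e : X := ‖u‖⁻¹ • u with he
    have heC : e ∈ C := hC.2.2.1 _ (by positivity) u hu
    have he1 : ‖e‖ = 1 := by rw [he, norm_smul, norm_inv, norm_norm, inv_mul_cancel₀ hn.ne']
    have hTu : T z u = ‖u‖ • T z e := by
      rw [he, map_smul, smul_smul, mul_inv_cancel₀ hn.ne', one_smul]
    have hTe : 1 ≤ ‖T z e‖ := by
      rw [hTu, norm_smul, norm_norm] at hle
      exact (le_mul_iff_one_le_right hn).1 hle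
    have hdiff : ‖T z e - T z₀ e‖ ≤ η := by
      have := (T z - T z₀).le_opNorm e
      rw [he1, mul_one] at this
      exact this.trans hz'.le
    have hη1 : η ≤ 1 / 2 := min_le_left _ _
    have hη2 : ‖f‖ * η ≤ δ := by
      have h1 : η ≤ δ / (‖f‖ + 1) := min_le_right _ _
      rw [le_div_iff₀ (by positivity)] at h1
      nlinarith
    have hhalf : 1 / 2 ≤ ‖T z₀ e‖ := by
      have := norm_sub_norm_le (T z e) (T z₀ e)
      linarith
    have h2 : 2 * δ ≤ f (T z₀ e) :=
      hδQ _ ⟨hTQ ⟨e, by simp [he1], rfl⟩, hpos _ e heC, hhalf⟩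
    have h3 : |f (T z e) - f (T z₀ e)| ≤ δ := by
      rw [← map_sub, ← Real.norm_eq_abs]
      exact (f.le_opNorm _).trans ((mul_le_mul_of_nonneg_left hdiff (norm_nonneg _)).trans hη2)
    have h4 : ‖T z e‖ ≤ ‖T z₀‖ + 1 := by
      have h5 := norm_sub_norm_le (T z e) (T z₀ e)
      have h6 := (T z₀).le_opNorm e
      rw [he1, mul_one] at h6
      linarith
    have h5 : δ / (‖T z₀‖ + 1) * ‖T z e‖ ≤ f (T z e) := by
      rw [div_mul_eq_mul_div, div_le_iff₀ (by positivity)]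
      have := (abs_le.1 h3).1
      have h7 : δ ≤ f (T z e) := by linarith
      nlinarith [norm_nonneg (T z₀)]
    rw [hTu, norm_smul, norm_norm, f.map_smul, smul_eq_mul]
    calc _ = ‖u‖ * (δ / (‖T z₀‖ + 1) * ‖T z e‖) := by ring
      _ ≤ _ := mul_le_mul_of_nonneg_left h5 hn.le

/-- If a cocycle of positive operators satisfies the norm control of
`IsCompact.exists_mul_norm_le_dual` and the functional grows at most quadratically along an
interior vector, then the operator norms grow at most quadratically. -/
theorem exists_norm_le_of_dual_le {C : Set X} {f : X →L[ℝ] ℝ}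
    (hf : ∀ w ∈ C, 0 ≤ f w) {v : X} (hv : v ∈ interior C) {D T : ℕ → X →L[ℝ] X}
    (hD0 : D 0 = ContinuousLinearMap.id ℝ X) (hD : ∀ n, D (n + 1) = (T n).comp (D n))
    (hpos : ∀ n, ∀ u ∈ C, D n u ∈ C) {δ : ℝ} (hδ : 0 < δ)
    (hT : ∀ n, ∀ u ∈ C, ‖u‖ ≤ ‖T n u‖ → δ * ‖T n u‖ ≤ f (T n u))
    {A : ℝ} (hA : ∀ n : ℕ, f (D n v) ≤ A * (n + 1) ^ 2) :
    ∃ a b : ℝ, ∀ n : ℕ, ‖D n‖ ≤ a + b * (n + 1) ^ 2 := by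
  have hA0 : 0 ≤ A := by
    have := (hf _ (hpos 0 v (interior_subset hv))).trans (hA 0)
    simpa using this
  obtain ⟨r, hr, hrC⟩ := Metric.nhds_basis_closedBall.mem_iff.1 (mem_interior_iff_mem_nhds.1 hv)
  have hmem : ∀ u : X, ‖u‖ ≤ r → v + u ∈ C := fun u hu => hrC (by simpa using hu)
  have key : ∀ u : X, ‖u‖ ≤ r → ∀ n : ℕ,
      ‖D n (v + u)‖ ≤ (‖v‖ + r) + 2 * A * (n + 1) ^ 2 / δ := by
    intro u hu n
    have hfu : ∀ k, f (D k (v + u)) ≤ 2 * A * (k + 1) ^ 2 := fun k => by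
      have h1 := hf _ (hpos k _ (hmem (-u) (by simpa using hu)))
      have h2 := hA k
      simp only [map_add, map_neg] at h1 ⊢
      linarith
    induction n with
    | zero =>
      have h1 : 0 ≤ 2 * A * (((0 : ℕ) : ℝ) + 1) ^ 2 / δ := by positivity
      rw [hD0, ContinuousLinearMap.id_apply]
      linarith [norm_add_le v u]
    | succ n ih =>
      have hk := hfu (n + 1)
      rw [hD, ContinuousLinearMap.comp_apply] at hk ⊢
      rcases le_total ‖D n (v + u)‖ ‖T n (D n (v + u))‖ with h | h
      · have h1 := (hT n _ (hpos n _ (hmem u hu)) h).trans hk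
        rw [mul_comm, ← le_div_iff₀ hδ] at h1
        linarith [norm_nonneg v]
      · refine h.trans (ih.trans ?_)
        push_cast
        gcongr
        linarith
  refine ⟨2 * (‖v‖ + r) / r, 4 * A / δ / r, fun n => ?_⟩
  refine ContinuousLinearMap.opNorm_le_of_unit_norm (by positivity) fun u hu => ?_
  have h1 := key (r • u) (by rw [norm_smul, hu, Real.norm_of_nonneg hr.le, mul_one]) n
  have h2 := key 0 (by simpa using hr.le) n
  have h3 : r * ‖D n u‖ ≤ ‖D n (v + r • u)‖ + ‖D n (v + 0)‖ := by
    have : r • D n u = D n (v + r • u) - D n (v + 0) := by simp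
    calc r * ‖D n u‖ = ‖r • D n u‖ := by rw [norm_smul, Real.norm_of_nonneg hr.le]
      _ ≤ _ := this ▸ norm_sub_le _ _
  have h4 : ‖D n u‖ ≤ (2 * ((‖v‖ + r) + 2 * A * (n + 1) ^ 2 / δ)) / r := by
    rw [le_div_iff₀ hr]
    linarith
  refine h4.trans_eq ?_
  ring

end ConePositivity

section Semiflow

variable {X : Type*} [NormedAddCommGroup X] [NormedSpace ℝ X] {Φ : ℝ → X → X}

theorem IsSemiflow.contDiff (hΦ : IsSemiflow Φ) (hC1 : ∀ t : ℝ, 0 < t → ContDiff ℝ 1 (Φ t))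
    {t : ℝ} (ht : 0 ≤ t) : ContDiff ℝ 1 (Φ t) := by
  rcases ht.eq_or_lt with rfl | ht
  · rw [show Φ 0 = id from funext hΦ.1]
    exact contDiff_id
  · exact hC1 t ht

theorem IsSemiflow.differentiable (hΦ : IsSemiflow Φ)
    (hC1 : ∀ t : ℝ, 0 < t → ContDiff ℝ 1 (Φ t)) {t : ℝ} (ht : 0 ≤ t) :
    Differentiable ℝ (Φ t) :=
  (hΦ.contDiff hC1 ht).differentiable one_ne_zero

theorem IsSemiflow.continuous_fderiv (hΦ : IsSemiflow Φ)
    (hC1 : ∀ t : ℝ, 0 < t → ContDiff ℝ 1 (Φ t)) {t : ℝ} (ht : 0 ≤ t) :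
    Continuous (fderiv ℝ (Φ t)) :=
  (hΦ.contDiff hC1 ht).continuous_fderiv one_ne_zero

theorem IsSemiflow.fderiv_add (hΦ : IsSemiflow Φ)
    (hC1 : ∀ t : ℝ, 0 < t → ContDiff ℝ 1 (Φ t)) {s t : ℝ} (hs : 0 ≤ s) (ht : 0 ≤ t) (x : X) :
    fderiv ℝ (Φ (t + s)) x = (fderiv ℝ (Φ t) (Φ s x)).comp (fderiv ℝ (Φ s) x) := by
  rw [show Φ (t + s) = Φ t ∘ Φ s from funext (hΦ.2.1 s t hs ht)]
  exact fderiv_comp x (hΦ.differentiable hC1 ht _) (hΦ.differentiable hC1 hs _)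

theorem IsSemiflow.continuous_abs {Y : Type*} [NormedAddCommGroup Y] {Ψ : ℝ → Y → Y}
    (hΨ : IsSemiflow Ψ) (y : Y) :
    Continuous fun t : ℝ => Ψ |t| y :=
  hΨ.2.2.comp_continuous (f := fun t : ℝ => (|t|, y)) (by fun_prop) fun t =>
    ⟨abs_nonneg t, Set.mem_univ _⟩

theorem IsSemiflow.fderiv_mem_cone (hΦ : IsSemiflow Φ)
    (hC1 : ∀ t : ℝ, 0 < t → ContDiff ℝ 1 (Φ t)) {C : Set X} (hC : IsCone C)
    (hmono : ∀ t : ℝ, 0 < t → ∀ x y : X, coneLT C x y → coneLLT C (Φ t x) (Φ t y))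
    {t : ℝ} (ht : 0 ≤ t) (x : X) {w : X} (hw : w ∈ C) : fderiv ℝ (Φ t) x w ∈ C := by
  rcases ht.eq_or_lt with rfl | ht'
  · rw [show Φ 0 = id from funext hΦ.1, fderiv_id]
    exact hw
  rcases eq_or_ne w 0 with rfl | hw0
  · simpa using hC.zero_mem
  refine hC.1.mem_of_tendsto ((hΦ.differentiable hC1 ht x).hasFDerivAt.lim_real w) ?_
  filter_upwards [eventually_gt_atTop 0] with c hc
  refine hC.2.2.1 c hc _ (interior_subset (hmono t ht' _ _ ⟨?_, ?_⟩))
  · simpa using hC.2.2.1 c⁻¹ (by positivity) w hw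
  · simp [hc.ne', hw0]

/-- The derivatives of the semiflow along a relatively compact orbit are bounded, uniformly for
times in a compact interval of positive times. -/
theorem IsSemiflow.exists_norm_fderiv_le [TopologicalSpace.SeparableSpace X] (hΦ : IsSemiflow Φ)
    (hC1 : ∀ t : ℝ, 0 < t → ContDiff ℝ 1 (Φ t)) {x : X}
    (horb : IsCompact (closure {y : X | ∃ t : ℝ, 0 ≤ t ∧ y = Φ t x})) {τ : ℝ} (hτ : 0 < τ) :
    ∃ M : ℝ, ∀ t ∈ Icc τ (2 * τ), ∀ r : ℝ, 0 ≤ r → ‖fderiv ℝ (Φ t) (Φ r x)‖ ≤ M := by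
  borelize X
  let A : ℕ → Set ℝ := fun n => {s | ∀ r : ℝ, ‖fderiv ℝ (Φ |s|) (Φ |r| x)‖ ≤ n}
  have hAmono : Monotone A := fun m n hmn s hs r => (hs r).trans (by exact_mod_cast hmn)
  have hAunion : ⋃ n, A n = univ := by
    refine Set.eq_univ_of_forall fun s => Set.mem_iUnion.2 ?_
    obtain ⟨B, hB⟩ := horb.exists_bound_of_continuousOn
      (hΦ.continuous_fderiv hC1 (abs_nonneg s)).continuousOn
    obtain ⟨n, hn⟩ := exists_nat_ge B
    exact ⟨n, fun r => (hB _ (subset_closure ⟨|r|, abs_nonneg r, rfl⟩)).trans hn⟩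
  have hderiv : ∀ y v : X, Measurable fun s : ℝ => fderiv ℝ (Φ |s|) y v := by
    intro y v
    have hlim : ∀ s : ℝ, Tendsto (fun n : ℕ => (n : ℝ) • (Φ |s| (y + (n : ℝ)⁻¹ • v) - Φ |s| y))
        atTop (𝓝 (fderiv ℝ (Φ |s|) y v)) := fun s =>
      ((hΦ.differentiable hC1 (abs_nonneg s) y).hasFDerivAt.lim_real v).comp
        tendsto_natCast_atTop_atTop
    refine measurable_of_tendsto_metrizable (fun n => ?_) (tendsto_pi_nhds.2 hlim)
    exact (((hΦ.continuous_abs _).sub (hΦ.continuous_abs _)).const_smul (n : ℝ)).measurable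
  have hAmeas : ∀ n, MeasurableSet (A n) := by
    intro n
    have hA : A n = ⋂ (q : ℚ) (k : ℕ), {s : ℝ | ‖fderiv ℝ (Φ |s|) (Φ |(q : ℝ)| x)
        (TopologicalSpace.denseSeq X k)‖ ≤ n * ‖TopologicalSpace.denseSeq X k‖} := by
      ext s
      simp only [A, Set.mem_iInter, Set.mem_ofPred_eq]
      refine ⟨fun h q k => ?_, fun h => ?_⟩
      · exact (ContinuousLinearMap.le_opNorm _ _).trans
          (mul_le_mul_of_nonneg_right (h q) (norm_nonneg _))
      · have hq : ∀ q : ℚ, ‖fderiv ℝ (Φ |s|) (Φ |(q : ℝ)| x)‖ ≤ n := fun q =>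
          ContinuousLinearMap.opNorm_le_bound _ (Nat.cast_nonneg n) fun v =>
            (TopologicalSpace.denseRange_denseSeq X).induction_on v
              (isClosed_le (by fun_prop) (by fun_prop)) (h q)
        exact fun r => Rat.denseRange_cast.induction_on r
          (isClosed_le (((hΦ.continuous_fderiv hC1 (abs_nonneg s)).comp
            (hΦ.continuous_abs x)).norm) continuous_const) hq
    rw [hA]
    exact MeasurableSet.iInter fun q => MeasurableSet.iInter fun k =>
      measurableSet_le (hderiv _ _).norm measurable_const
  obtain ⟨n, hn⟩ : ∃ n, volume (Icc 0 (2 * τ) \ A n) < ENNReal.ofReal (τ / 2) := by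
    have hlim : Tendsto (fun n => volume (Icc 0 (2 * τ) \ A n)) atTop
        (𝓝 (volume (⋂ n, Icc 0 (2 * τ) \ A n))) :=
      tendsto_measure_iInter_atTop
        (fun n => (measurableSet_Icc.diff (hAmeas n)).nullMeasurableSet)
        (fun m n hmn => Set.sdiff_subset_sdiff_right (hAmono hmn))
        ⟨0, ((measure_mono Set.sdiff_subset).trans_lt measure_Icc_lt_top).ne⟩
    rw [← Set.sdiff_iUnion, hAunion, Set.sdiff_univ, measure_empty] at hlim
    exact (hlim.eventually_lt_const (by simpa using hτ)).exists
  refine ⟨n * n, fun t ht r hr => ?_⟩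
  obtain ⟨s, hs, hsA, htA⟩ : ∃ s ∈ Icc 0 τ, s ∈ A n ∧ t - s ∈ A n := by
    by_contra! h
    have hsub : Icc 0 τ ⊆ (Icc 0 (2 * τ) \ A n) ∪ (fun s => t - s) ⁻¹' (Icc 0 (2 * τ) \ A n) := by
      intro s hs
      by_cases hsA : s ∈ A n
      · exact Or.inr ⟨⟨by linarith [hs.2, ht.1], by linarith [hs.1, ht.2]⟩, h s hs hsA⟩
      · exact Or.inl ⟨⟨hs.1, by linarith [hs.2]⟩, hsA⟩
    have h1 := (measure_mono hsub).trans (measure_union_le (μ := volume) _ _)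
    rw [(Measure.measurePreserving_sub_left volume t).measure_preimage
      (measurableSet_Icc.diff (hAmeas n)).nullMeasurableSet, Real.volume_Icc] at h1
    have h2 := h1.trans_lt (ENNReal.add_lt_add hn hn)
    rw [← ENNReal.ofReal_add (by positivity) (by positivity)] at h2
    simp at h2
  have hts : 0 ≤ t - s := by linarith [hs.2, ht.1]
  have h1 : ‖fderiv ℝ (Φ s) (Φ r x)‖ ≤ n := by
    simpa only [abs_of_nonneg hs.1, abs_of_nonneg hr] using hsA r
  have h2 : ‖fderiv ℝ (Φ (t - s)) (Φ s (Φ r x))‖ ≤ n := by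
    rw [← hΦ.2.1 r s hr hs.1]
    simpa only [abs_of_nonneg hts, abs_of_nonneg (add_nonneg hs.1 hr)] using htA (s + r)
  have h3 := hΦ.fderiv_add hC1 hs.1 hts (Φ r x)
  rw [sub_add_cancel] at h3
  rw [h3]
  exact (ContinuousLinearMap.opNorm_comp_le _ _).trans
    (mul_le_mul h2 h1 (norm_nonneg _) (Nat.cast_nonneg n))

/-- A positive Lyapunov exponent is detected by exponential growth along multiples of `τ`. -/
theorem IsSemiflow.lambdaMaxFlow_pos_iff [TopologicalSpace.SeparableSpace X] (hΦ : IsSemiflow Φ)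
    (hC1 : ∀ t : ℝ, 0 < t → ContDiff ℝ 1 (Φ t)) {x : X}
    (horb : IsCompact (closure {y : X | ∃ t : ℝ, 0 ≤ t ∧ y = Φ t x})) {τ : ℝ} (hτ : 0 < τ) :
    0 < lambdaMaxFlow Φ x ↔ ∃ k N : ℕ, ∀ n ≥ N,
      Real.exp ((k + 1 : ℝ)⁻¹ * n) < ‖fderiv ℝ (Φ (n * τ)) x‖ := by
  constructor
  · intro h
    obtain ⟨c, hc0, hc⟩ := EReal.lt_iff_exists_real_btwn.1 h
    have hc0 : 0 < c := by exact_mod_cast hc0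
    obtain ⟨k, hk⟩ := exists_nat_one_div_lt (mul_pos hc0 hτ)
    have hev := eventually_lt_of_lt_liminf hc
    have hseq : Tendsto (fun n : ℕ => (n : ℝ) * τ) atTop atTop :=
      tendsto_natCast_atTop_atTop.atTop_mul_const hτ
    obtain ⟨N, hN⟩ := eventually_atTop.1 ((hseq.eventually hev).and (eventually_gt_atTop 0))
    refine ⟨k, N, fun n hn => ?_⟩
    obtain ⟨h1, hn0⟩ := hN n hn
    have hn0 : (0 : ℝ) < n := by exact_mod_cast hn0
    have h1 : c < Real.log ‖fderiv ℝ (Φ (n * τ)) x‖ / (n * τ) := by exact_mod_cast h1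
    rw [lt_div_iff₀ (by positivity)] at h1
    have hne : ‖fderiv ℝ (Φ (n * τ)) x‖ ≠ 0 := by
      intro h0
      rw [h0, Real.log_zero] at h1
      exact absurd h1 (not_lt.2 (by positivity))
    rw [← Real.lt_log_iff_exp_lt (lt_of_le_of_ne (norm_nonneg _) hne.symm)]
    refine lt_trans ?_ h1
    rw [one_div] at hk
    nlinarith
  · rintro ⟨k, N, h⟩
    obtain ⟨M, hM⟩ := hΦ.exists_norm_fderiv_le hC1 horb hτ
    set q : ℝ := (k + 1 : ℝ)⁻¹
    have hq0 : 0 < q := by positivity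
    set M' : ℝ := max M 1
    have hM'0 : 0 < M' := lt_max_of_lt_right one_pos
    have hpos : (0 : EReal) < ((q / (2 * τ) : ℝ) : EReal) := by
      exact_mod_cast (by positivity : 0 < q / (2 * τ))
    refine hpos.trans_le (le_liminf_of_le (by isBoundedDefault) ?_)
    filter_upwards [eventually_gt_atTop 0, eventually_ge_atTop (N * τ),
      eventually_ge_atTop (2 * τ * Real.log M' / q)] with t ht0 htN htM
    rw [EReal.coe_le_coe_iff]
    set n : ℕ := ⌊t / τ⌋₊ + 2 with hn
    have hfl : (⌊t / τ⌋₊ : ℝ) * τ ≤ t := by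
      rw [← le_div_iff₀ hτ]
      exact Nat.floor_le (by positivity)
    have hfl' : t < (⌊t / τ⌋₊ + 1 : ℝ) * τ := by
      rw [← div_lt_iff₀ hτ]
      exact Nat.lt_floor_add_one _
    have hnN : N ≤ n := by
      have : N ≤ ⌊t / τ⌋₊ := Nat.le_floor ((le_div_iff₀ hτ).2 htN)
      omega
    have hnτ : n * τ - t ∈ Icc τ (2 * τ) := by
      constructor <;> · rw [hn]; push_cast; linarith
    have hcomp := hΦ.fderiv_add hC1 ht0.le (hτ.le.trans hnτ.1) x
    rw [sub_add_cancel] at hcomp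
    have hlow := h n hnN
    have hup : ‖fderiv ℝ (Φ (n * τ)) x‖ ≤ M' * ‖fderiv ℝ (Φ t) x‖ := by
      rw [hcomp]
      refine (ContinuousLinearMap.opNorm_comp_le _ _).trans ?_
      exact mul_le_mul_of_nonneg_right ((hM _ hnτ t ht0.le).trans (le_max_left _ _))
        (norm_nonneg _)
    have hexp := hlow.trans_le hup
    have hDpos : 0 < ‖fderiv ℝ (Φ t) x‖ :=
      pos_of_mul_pos_right ((Real.exp_pos _).trans hexp) hM'0.le
    rw [← Real.lt_log_iff_exp_lt (by positivity), Real.log_mul hM'0.ne' hDpos.ne'] at hexp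
    rw [div_le_div_iff₀ (by positivity) ht0]
    rw [div_le_iff₀ hq0] at htM
    have hnt : t ≤ n * τ := by linarith [hnτ.1]
    nlinarith

end Semiflow

section Lines

variable {X : Type*} [NormedAddCommGroup X] [NormedSpace ℝ X] {Φ : ℝ → X → X}

/-- Along almost every point of a segment in a cone direction, the derivatives of the iterates in
that direction grow at most quadratically when measured by a nonnegative functional. -/
theorem IsSemiflow.ae_exists_dual_fderiv_le (hΦ : IsSemiflow Φ)
    (hC1 : ∀ t : ℝ, 0 < t → ContDiff ℝ 1 (Φ t)) {C : Set X} (hC : IsCone C)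
    (hmono : ∀ t : ℝ, 0 < t → ∀ x y : X, coneLT C x y → coneLLT C (Φ t x) (Φ t y))
    (horb : ∀ x : X, IsCompact (closure {y : X | ∃ t : ℝ, 0 ≤ t ∧ y = Φ t x}))
    {f : X →L[ℝ] ℝ} (hf : ∀ w ∈ C, 0 ≤ f w) {v : X} (hv : v ∈ C) {τ : ℝ} (hτ : 0 < τ) (x : X) :
    ∀ᵐ s : ℝ ∂volume.restrict (Ioc 0 1), ∃ A : ℝ, ∀ n : ℕ,
      f (fderiv ℝ (Φ (n * τ)) (x + s • v) v) ≤ A * (n + 1) ^ 2 := by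
  obtain ⟨B₀, hB₀⟩ := (horb x).exists_bound_of_continuousOn f.continuous.continuousOn
  obtain ⟨B₁, hB₁⟩ := (horb (x + v)).exists_bound_of_continuousOn f.continuous.continuousOn
  let g : ℕ → ℝ → ℝ := fun n s => f (fderiv ℝ (Φ (n * τ)) (x + s • v) v)
  have hnτ : ∀ n : ℕ, 0 ≤ n * τ := fun n => by positivity
  have hg0 : ∀ n s, 0 ≤ g n s := fun n s =>
    hf _ (hΦ.fderiv_mem_cone hC1 hC hmono (hnτ n) _ hv)
  have hgc : ∀ n, Continuous (g n) := fun n => by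
    have h := hΦ.continuous_fderiv hC1 (hnτ n)
    have h' : Continuous fun s : ℝ => fderiv ℝ (Φ (n * τ)) (x + s • v) := h.comp (by fun_prop)
    exact f.continuous.comp (h'.clm_apply continuous_const)
  have hint : ∀ n, ∫⁻ s in Ioc 0 1, ENNReal.ofReal (g n s) ≤ ENNReal.ofReal (B₀ + B₁) := by
    intro n
    have hderiv : ∀ s : ℝ, HasDerivAt (fun s : ℝ => f (Φ (n * τ) (x + s • v))) (g n s) s := by
      intro s
      have h1 : HasDerivAt (fun s : ℝ => x + s • v) v s := by
        simpa using ((hasDerivAt_id s).smul_const v).const_add x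
      exact f.hasFDerivAt.comp_hasDerivAt s
        ((hΦ.differentiable hC1 (hnτ n) (x + s • v)).hasFDerivAt.comp_hasDerivAt s h1)
    have hI : ∫ s in (0 : ℝ)..1, g n s = f (Φ (n * τ) (x + v)) - f (Φ (n * τ) x) := by
      rw [intervalIntegral.integral_eq_sub_of_hasDerivAt (fun s _ => hderiv s)
        ((hgc n).intervalIntegrable _ _)]
      simp
    rw [intervalIntegral.integral_of_le zero_le_one] at hI
    rw [← ofReal_integral_eq_lintegral_ofReal
      ((hgc n).integrableOn_Ioc) (Eventually.of_forall (hg0 n)), hI]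
    refine ENNReal.ofReal_le_ofReal ?_
    have h0 := hB₀ _ (subset_closure ⟨n * τ, hnτ n, rfl⟩)
    have h1 := hB₁ _ (subset_closure ⟨n * τ, hnτ n, rfl⟩)
    rw [Real.norm_eq_abs] at h0 h1
    linarith [(abs_le.1 h0).1, (abs_le.1 h1).2]
  let c : ℕ → ℝ := fun n => (((n : ℝ) + 1) ^ 2)⁻¹
  have hc : Summable c := by
    have := (summable_nat_add_iff 1).2 (Real.summable_nat_pow_inv.2 one_lt_two)
    simpa [c] using this
  have hc0 : ∀ n, 0 ≤ c n := fun n => by positivity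
  have hmeas : ∀ n, Measurable fun s => ENNReal.ofReal (c n) * ENNReal.ofReal (g n s) :=
    fun n => (hgc n).measurable.ennreal_ofReal.const_mul _
  have hfin : ∫⁻ s in Ioc 0 1, ∑' n, ENNReal.ofReal (c n) * ENNReal.ofReal (g n s) ≠ ∞ := by
    rw [lintegral_tsum fun n => (hmeas n).aemeasurable]
    have hle : ∑' n, ∫⁻ s in Ioc 0 1, ENNReal.ofReal (c n) * ENNReal.ofReal (g n s) ≤
        ∑' n, ENNReal.ofReal (c n) * ENNReal.ofReal (B₀ + B₁) := by
      refine ENNReal.tsum_le_tsum fun n => ?_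
      rw [lintegral_const_mul _ (hgc n).measurable.ennreal_ofReal]
      exact mul_le_mul_right (hint n) _
    refine ne_top_of_le_ne_top ?_ hle
    rw [ENNReal.tsum_mul_right]
    exact ENNReal.mul_ne_top hc.tsum_ofReal_ne_top ENNReal.ofReal_ne_top
  filter_upwards [ae_lt_top (Measurable.tsum hmeas) hfin] with s hs
  refine ⟨(∑' n, ENNReal.ofReal (c n) * ENNReal.ofReal (g n s)).toReal, fun n => ?_⟩
  have h1 := ENNReal.toReal_mono hs.ne
    (ENNReal.le_tsum (f := fun n => ENNReal.ofReal (c n) * ENNReal.ofReal (g n s)) n)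
  rw [ENNReal.toReal_mul, ENNReal.toReal_ofReal (hc0 n), ENNReal.toReal_ofReal (hg0 n s)] at h1
  exact (inv_mul_le_iff₀' (by positivity)).1 h1

/-- A sequence bounded by a quadratic polynomial does not dominate a growing exponential. -/
theorem not_exp_lt_of_le_quadratic {u : ℕ → ℝ} {a b q : ℝ} (hq : 0 < q)
    (hu : ∀ n : ℕ, u n ≤ a + b * (n + 1) ^ 2) (N : ℕ) :
    ¬ ∀ n ≥ N, Real.exp (q * n) < u n := by
  intro h
  have h1 : Tendsto (fun t : ℝ => (a + b * (t + 1) ^ 2) / Real.exp (q * t)) atTop (𝓝 0) := by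
    have hp : ∀ k : ℕ, Tendsto (fun t : ℝ => t ^ k / Real.exp (q * t)) atTop (𝓝 0) := fun k =>
      (isLittleO_pow_exp_pos_mul_atTop k hq).tendsto_div_nhds_zero
    have := ((hp 0).const_mul (a + b)).add
      (((hp 1).const_mul (2 * b)).add ((hp 2).const_mul b))
    simp only [mul_zero, add_zero] at this
    refine this.congr fun t => ?_
    ring
  have h2 := (h1.comp tendsto_natCast_atTop_atTop).eventually_lt_const one_pos
  obtain ⟨n, hn1, hnN⟩ := (h2.and (eventually_ge_atTop N)).exists
  rw [Function.comp_apply, div_lt_one (Real.exp_pos _)] at hn1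
  linarith [h n hnN, hu n]

end Lines

/-- **Theorem C** (No observable chaos for semiflows). For a `C¹`-smooth strongly
monotone semiflow with compact orbit closures on a strongly ordered separable Banach
space, such that `DΦ_{t₀}(x)` is compact for all `x` and strongly positive at every
equilibrium, the set `S_Φ = {x : λ_max(x,Φ) > 0}` is shy. -/
theorem no_observable_chaos_semiflow
    {X : Type*} [NormedAddCommGroup X] [NormedSpace ℝ X] [CompleteSpace X]
    [TopologicalSpace.SeparableSpace X] [MeasurableSpace X] [BorelSpace X]
    (C : Set X) (hC : StronglyOrderedCone C)
    (Φ : ℝ → X → X) (hΦ : IsSemiflow Φ)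
    (hC1 : ∀ t : ℝ, 0 < t → ContDiff ℝ 1 (Φ t))
    (hmono : ∀ t : ℝ, 0 < t → ∀ x y : X, coneLT C x y → coneLLT C (Φ t x) (Φ t y))
    (horb : ∀ x : X, IsCompact (closure {y : X | ∃ t : ℝ, 0 ≤ t ∧ y = Φ t x}))
    (t₀ : ℝ) (ht₀ : 0 < t₀)
    (hcptD : ∀ x : X, IsCompactOperator (fderiv ℝ (Φ t₀) x))
    (hposD : ∀ e : X, (∀ t : ℝ, 0 ≤ t → Φ t e = e) →
      StronglyPositive C (fderiv ℝ (Φ t₀) e)) :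
    IsShy {x : X | 0 < lambdaMaxFlow Φ x} := by
  obtain ⟨hC, v, hv⟩ := hC
  have hiff := fun x => hΦ.lambdaMaxFlow_pos_iff hC1 (horb x) ht₀
  obtain ⟨f, hf⟩ := hC.exists_strictlyPositive_dual
  have hf0 : ∀ w ∈ C, 0 ≤ f w := fun w hw => by
    rcases eq_or_ne w 0 with rfl | hw0
    · simp
    · exact (hf w hw hw0).le
  have hmeas : MeasurableSet {x : X | 0 < lambdaMaxFlow Φ x} := by
    simp only [hiff, Set.ofPred_exists, Set.ofPred_forall]
    refine MeasurableSet.iUnion fun k => MeasurableSet.iUnion fun N =>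
      MeasurableSet.iInter fun n => MeasurableSet.iInter fun _ =>
        (isOpen_lt continuous_const ?_).measurableSet
    exact (hΦ.continuous_fderiv hC1 (by positivity)).norm
  have hgrowth : ∀ y : X, (∃ A : ℝ, ∀ n : ℕ,
      f (fderiv ℝ (Φ (n * t₀)) y v) ≤ A * (n + 1) ^ 2) → ¬ 0 < lambdaMaxFlow Φ y := by
    rintro y ⟨A, hA⟩ hy
    obtain ⟨δ, hδ, hδK⟩ := (horb y).exists_mul_norm_le_dual hC hf
      (hΦ.continuous_fderiv hC1 ht₀.le) hcptD
      fun z u hu => hΦ.fderiv_mem_cone hC1 hC hmono ht₀.le z hu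
    obtain ⟨a, b, hab⟩ := exists_norm_le_of_dual_le hf0 hv
      (D := fun n => fderiv ℝ (Φ (n * t₀)) y)
      (T := fun n => fderiv ℝ (Φ t₀) (Φ (n * t₀) y))
      (by simp [show Φ 0 = id from funext hΦ.1])
      (fun n => by
        rw [← hΦ.fderiv_add hC1 (by positivity) ht₀.le]
        congr 2
        push_cast
        ring)
      (fun n u hu => hΦ.fderiv_mem_cone hC1 hC hmono (by positivity) y hu) hδ
      (fun n => hδK _ (subset_closure ⟨n * t₀, by positivity, rfl⟩)) hA
    obtain ⟨k, N, h⟩ := (hiff y).1 hy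
    exact not_exp_lt_of_le_quadratic (by positivity) hab N h
  have hline : Continuous fun s : ℝ => s • v := by fun_prop
  refine ⟨hmeas, (volume.restrict (Ioc (0 : ℝ) 1)).map fun s : ℝ => s • v, ?_,
    ⟨(fun s : ℝ => s • v) '' Icc 0 1, isCompact_Icc.image hline, ?_⟩, fun x => ?_⟩
  · rw [Ne, Measure.map_eq_zero_iff hline.measurable.aemeasurable, Measure.restrict_eq_zero]
    simp
  · rw [Measure.map_apply hline.measurable
      (isCompact_Icc.image hline).isClosed.isOpen_compl.measurableSet]
    refine measure_mono_null (t := (Icc (0 : ℝ) 1)ᶜ) (fun s hs hs' => hs ⟨s, hs', rfl⟩) ?_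
    rw [Measure.restrict_apply measurableSet_Icc.compl]
    exact measure_mono_null (fun s hs => hs.1 (Ioc_subset_Icc_self hs.2)) measure_empty
  · have hpre : (fun w => x + w) '' {y : X | 0 < lambdaMaxFlow Φ y} =
        (fun w => -x + w) ⁻¹' {y : X | 0 < lambdaMaxFlow Φ y} := by
      rw [Set.image_add_left]
    rw [hpre, Measure.map_apply hline.measurable ((measurable_const_add _) hmeas)]
    refine measure_mono_null (fun s hs => ?_)
      (hΦ.ae_exists_dual_fderiv_le hC1 hC hmono horb hf0 (interior_subset hv) ht₀ (-x))
    exact fun h => hgrowth _ h hs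

end
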